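/- Moving averages, anchored spectral tail process and extremal index: Let α > 0, let C = (C_i)_{i∈ℤ^d} be a random element of l₀ with E[‖C‖^α] > 0 and c := Σ_{k∈ℤ^d} E[|C_k|^α] ∈ (0,∞), and let κ be a {−1,1}-valued random variable independent of C. Let Y be a tail process in l₀ with index α (i.e. Y is a random element of ℝ₀^{ℤ^d} satisfying the tail-process identity, |Y_0| is Pareto(α)-distributed and independent of Θ = Y/|Y_0|, and P(Θ ∈ l₀) = 1) whose spectral process Θ satisfies E[h(Θ)] = c^{−1} E[Σ_{k∈ℤ^d} h(κ·θ_k C/|C_k|) |C_k|^α] for all measurable h : l₀ → [0,∞). Let Q be a random element of l₀ with law P(Q ∈ ·) = E[1{κ·C/‖C‖ ∈ ·} ‖C‖^α] / E[‖C‖^α]. Then Q is a representative of the anchored spectral tail process, and the extremal index satisfies ϑ := E[1/|e(Y)|] = E[‖C‖^α] / Σ_{k∈ℤ^d} E[|C_k|^α]. -/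

import Mathlib

open MeasureTheory ENNReal Filter ProbabilityTheory

noncomputable section

/-- The space `ℝ^{ℤ^d}` of real-valued fields indexed by `ℤ^d`. -/
abbrev RField (d : ℕ) := (Fin d → ℤ) → ℝ

variable {d : ℕ}

/-- Shift operator: `shift k x = (x_{i+k})_i`, i.e. it moves the origin to `k`. -/
def shift (k : Fin d → ℤ) (x : RField d) : RField d := fun i => x (i + k)

/-- The set of exceedance-points of `x`. -/
def excSet (x : RField d) : Set (Fin d → ℤ) := {k | 1 < |x k|}

open Classical in
/-- Indicator (with values in `ℝ≥0∞`) of the event that `|x k| > s`. -/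
def exIndGT (s : ℝ) (k : Fin d → ℤ) (x : RField d) : ℝ≥0∞ := if s < |x k| then 1 else 0

/-- The tail-process identity:
`E[h(θ_k Y) 1{|Y_k| > 1}] = E[h(Y) 1{|Y_{−k}| > 1}]` for every measurable nonnegative `h`
and every `k ∈ ℤ^d`. -/
def TailIdentity {Ω : Type*} [MeasurableSpace Ω] (μ : Measure Ω) (Y : Ω → RField d) : Prop :=
  ∀ h : RField d → ℝ≥0∞, Measurable h → ∀ k : Fin d → ℤ,
    ∫⁻ ω, h (shift k (Y ω)) * exIndGT 1 k (Y ω) ∂μ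
      = ∫⁻ ω, h (Y ω) * exIndGT 1 (-k) (Y ω) ∂μ

/-- `Y` is exceedance-stationary: for every exceedance-map `τ` which is bijective on a
measurable set `B` (invariant under shifting the origin to exceedance-points, contained in
`ℝ₀^{ℤ^d}`) carrying the law of `Y`, we have `θ_τ Y ≐ Y`. -/
def ExcStationary {Ω : Type*} [MeasurableSpace Ω] (μ : Measure Ω) (Y : Ω → RField d) : Prop :=
  ∀ (B : Set (RField d)) (τ : RField d → Fin d → ℤ),
    MeasurableSet B → Measurable τ →
    (∀ x ∈ B, 1 < |x 0|) →
    (∀ x ∈ B, ∀ k ∈ excSet x, shift k x ∈ B) →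
    (∀ x ∈ B, τ x ∈ excSet x) →
    (∀ x ∈ B, Set.BijOn (fun k => k + τ (shift k x)) (excSet x) (excSet x)) →
    (∀ᵐ ω ∂μ, Y ω ∈ B) →
    Measure.map (fun ω => shift (τ (Y ω)) (Y ω)) μ = Measure.map Y μ

/-- `E₀`: elements of `ℝ₀^{ℤ^d}` with finitely many exceedance-points. -/
def E0set (d : ℕ) : Set (RField d) := {x | 1 < |x 0| ∧ (excSet x).Finite}

/-- `E`: elements of `ℝ^{ℤ^d}` with at least one but finitely many exceedance-points. -/
def Eset (d : ℕ) : Set (RField d) := {x | (excSet x).Nonempty ∧ (excSet x).Finite}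

/-- `l₀`: fields vanishing at infinity. -/
def l0set (d : ℕ) : Set (RField d) := {x | Tendsto (fun i => |x i|) cofinite (nhds 0)}

/-- Uniform norm `‖x‖ = sup_i |x_i|`. -/
def supNorm (x : RField d) : ℝ := ⨆ i, |x i|

/-- `V` is Pareto(α)-distributed: `P(V > y) = y^{-α}` for `y ≥ 1`. -/
def IsPareto {Ω : Type*} [MeasurableSpace Ω] (μ : Measure Ω) (V : Ω → ℝ) (α : ℝ) : Prop :=
  ∀ y : ℝ, 1 ≤ y → μ {ω | y < V ω} = ENNReal.ofReal (y ^ (-α))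

/-- An anchoring function on `S`: a measurable shift-covariant exceedance-map. -/
def IsAnchoringOn (S : Set (RField d)) (A : RField d → Fin d → ℤ) : Prop :=
  Measurable A ∧ ∀ x ∈ S, A x ∈ excSet x ∧ ∀ k ∈ excSet x, A (shift k x) + k = A x

/-- `h` is shift-invariant on `S`. -/
def ShiftInvariantOn (S : Set (RField d)) (h : RField d → ℝ≥0∞) : Prop :=
  ∀ x ∈ S, ∀ k : Fin d → ℤ, h (shift k x) = h x

/-- Data of a first-maximum anchoring function `A^{fm}`: a translation-invariant linear
(group) order `r` on `ℤ^d`, and a measurable map `Afm` which picks, for every nonzero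
`x ∈ l₀`, the `r`-smallest index at which `|x|` attains its maximum `‖x‖`. -/
structure FirstMaxData (d : ℕ) where
  r : (Fin d → ℤ) → (Fin d → ℤ) → Prop
  Afm : RField d → Fin d → ℤ
  r_linear : IsLinearOrder (Fin d → ℤ) r
  r_add_invariant : ∀ a b c : Fin d → ℤ, r a b → r (a + c) (b + c)
  meas : Measurable Afm
  mem_argmax : ∀ x ∈ l0set d, x ≠ 0 → |x (Afm x)| = supNorm x
  min_argmax : ∀ x ∈ l0set d, x ≠ 0 → ∀ k : Fin d → ℤ, |x k| = supNorm x → r (Afm x) k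

/-- `Q` (a random element of `l₀` on `(Ω₂, μ₂)`) is a representative of the anchored spectral
tail process of `Θ`: `E[h(Q)] = E[h(Θ) | A^{fm}(Θ) = 0]` for every shift-invariant
measurable `h : l₀ → [0,∞)`. -/
def IsSpectralRep {Ω : Type*} [MeasurableSpace Ω] (μ : Measure Ω) (Θ : Ω → RField d)
    (F : FirstMaxData d) {Ω₂ : Type*} [MeasurableSpace Ω₂] (μ₂ : Measure Ω₂)
    (Q : Ω₂ → RField d) : Prop :=
  ∀ h : RField d → ℝ≥0∞, Measurable h → ShiftInvariantOn (l0set d) h →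
    ∫⁻ ω, h (Q ω) ∂μ₂
      = ∫⁻ x, h x ∂(ProbabilityTheory.cond (Measure.map Θ μ) {x | F.Afm x = 0})

lemma bddAbove_range_abs_of_mem_l0set {x : RField d} (hx : x ∈ l0set d) :
    BddAbove (Set.range fun i => |x i|) :=
  Tendsto.bddAbove_range_of_cofinite hx

lemma abs_le_supNorm {x : RField d} (hx : x ∈ l0set d) (i : Fin d → ℤ) : |x i| ≤ supNorm x :=
  le_ciSup (bddAbove_range_abs_of_mem_l0set hx) i

lemma measurable_shift (k : Fin d → ℤ) : Measurable (shift k : RField d → RField d) :=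
  measurable_pi_lambda _ fun i => measurable_pi_apply (i + k)

lemma smul_mem_l0set {x : RField d} (hx : x ∈ l0set d) (a : ℝ) : a • x ∈ l0set d := by
  have h : Tendsto (fun i => |a| * |x i|) cofinite (nhds (|a| * 0)) := Tendsto.const_mul _ hx
  simpa [l0set, abs_mul] using h

lemma shift_mem_l0set {x : RField d} (hx : x ∈ l0set d) (k : Fin d → ℤ) :
    shift k x ∈ l0set d :=
  Tendsto.comp (f := fun i => i + k) hx (add_left_injective k).tendsto_cofinite

lemma supNorm_zero : supNorm (0 : RField d) = 0 := by simp [supNorm]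

lemma supNorm_smul (a : ℝ) (x : RField d) : supNorm (a • x) = |a| * supNorm x := by
  simp [supNorm, abs_mul, Real.mul_iSup_of_nonneg]

lemma supNorm_shift (k : Fin d → ℤ) (x : RField d) : supNorm (shift k x) = supNorm x :=
  (Equiv.addRight k).iSup_comp (g := fun i => |x i|)

lemma shift_smul (k : Fin d → ℤ) (a : ℝ) (x : RField d) : shift k (a • x) = a • shift k x := rfl

lemma shift_ne_zero {x : RField d} (hx : x ≠ 0) (k : Fin d → ℤ) : shift k x ≠ 0 := by
  contrapose! hx
  ext i
  simpa [shift] using congrFun hx (i - k)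

namespace FirstMaxData

lemma Afm_eq (F : FirstMaxData d) {x : RField d} (hx : x ∈ l0set d) (hx0 : x ≠ 0)
    {k : Fin d → ℤ} (hk : |x k| = supNorm x) (hmin : ∀ j, |x j| = supNorm x → F.r k j) :
    F.Afm x = k :=
  F.r_linear.antisymm _ _ (F.min_argmax x hx hx0 k hk) (hmin _ (F.mem_argmax x hx hx0))

lemma Afm_smul (F : FirstMaxData d) {x : RField d} (hx : x ∈ l0set d) (hx0 : x ≠ 0)
    {a : ℝ} (ha : a ≠ 0) : F.Afm (a • x) = F.Afm x := by
  refine F.Afm_eq (smul_mem_l0set hx a) (smul_ne_zero ha hx0) ?_ fun j hj => ?_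
  · simp [supNorm_smul, abs_mul, F.mem_argmax x hx hx0]
  · refine F.min_argmax x hx hx0 j ?_
    simpa [supNorm_smul, abs_mul, ha] using hj

lemma Afm_shift (F : FirstMaxData d) {x : RField d} (hx : x ∈ l0set d) (hx0 : x ≠ 0)
    (k : Fin d → ℤ) : F.Afm (shift k x) = F.Afm x - k := by
  refine F.Afm_eq (shift_mem_l0set hx k) (shift_ne_zero hx0 k) ?_ fun j hj => ?_
  · simp [supNorm_shift, shift, F.mem_argmax x hx hx0]
  · rw [supNorm_shift] at hj
    simpa [sub_eq_add_neg] using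
      F.r_add_invariant _ _ (-k) (F.min_argmax x hx hx0 (j + k) hj)

lemma measurableSet_Afm_eq (F : FirstMaxData d) (k : Fin d → ℤ) :
    MeasurableSet {x | F.Afm x = k} :=
  F.meas (measurableSet_singleton k)

end FirstMaxData

lemma measurable_exIndGT (s : ℝ) (k : Fin d → ℤ) :
    Measurable (exIndGT s k : RField d → ℝ≥0∞) :=
  Measurable.ite (measurableSet_lt measurable_const (measurable_pi_apply k).abs)
    measurable_const measurable_const

lemma encard_excSet_eq_tsum (x : RField d) :
    ((excSet x).encard : ℝ≥0∞) = ∑' k, exIndGT 1 k x := by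
  rw [← ENNReal.tsum_set_one, tsum_subtype (excSet x) fun _ => (1 : ℝ≥0∞)]
  exact tsum_congr fun k => by simp [exIndGT, excSet, Set.indicator_apply]

lemma measurable_encard_excSet : Measurable fun x : RField d => ((excSet x).encard : ℝ≥0∞) := by
  simp_rw [encard_excSet_eq_tsum]
  exact Measurable.tsum fun k => measurable_exIndGT 1 k

lemma encard_excSet_shift (k : Fin d → ℤ) (x : RField d) :
    (excSet (shift k x)).encard = (excSet x).encard := by
  have h : excSet (shift k x) = Equiv.addRight k ⁻¹' excSet x := rfl
  rw [h, Set.encard_preimage_of_bijective (Equiv.addRight k).bijective]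

lemma finite_excSet {x : RField d} (hx : x ∈ l0set d) : (excSet x).Finite := by
  have h : ∀ᶠ i in cofinite, |x i| < 1 := Tendsto.eventually_lt_const one_pos hx
  exact (eventually_cofinite.1 h).subset fun k hk => not_lt.2 (le_of_lt hk)

/-- The extremal index of a field satisfying the tail-process identity is the probability that
its first maximum sits at the origin. -/
lemma TailIdentity.lintegral_inv_encard {Ω : Type*} [MeasurableSpace Ω] {μ : Measure Ω}
    {Y : Ω → RField d} (hTI : TailIdentity μ Y) (hY : Measurable Y)
    (hl0 : ∀ᵐ ω ∂μ, Y ω ∈ l0set d) (hexc : ∀ᵐ ω ∂μ, 1 < |Y ω 0|) (F : FirstMaxData d) :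
    ∫⁻ ω, ((excSet (Y ω)).encard : ℝ≥0∞)⁻¹ ∂μ = μ {ω | F.Afm (Y ω) = 0} := by
  set h : RField d → ℝ≥0∞ :=
    {x | F.Afm x = 0}.indicator fun x => ((excSet x).encard : ℝ≥0∞)⁻¹ with h_def
  have hh : Measurable h := measurable_encard_excSet.inv.indicator (F.measurableSet_Afm_eq 0)
  calc ∫⁻ ω, ((excSet (Y ω)).encard : ℝ≥0∞)⁻¹ ∂μ
      = ∫⁻ ω, ∑' k, h (shift k (Y ω)) * exIndGT 1 k (Y ω) ∂μ := by
        refine lintegral_congr_ae ?_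
        filter_upwards [hl0, hexc] with ω h0 h1
        have hne : Y ω ≠ 0 := fun h => by norm_num [h] at h1
        have hmax : 1 < |Y ω (F.Afm (Y ω))| := by
          rw [F.mem_argmax _ h0 hne]
          exact h1.trans_le (abs_le_supNorm h0 0)
        rw [tsum_eq_single (F.Afm (Y ω))]
        · simp [h_def, F.Afm_shift h0 hne, encard_excSet_shift, exIndGT, hmax]
        · intro k hk
          simp [h_def, F.Afm_shift h0 hne, sub_eq_zero, hk.symm]
    _ = ∑' k, ∫⁻ ω, h (shift k (Y ω)) * exIndGT 1 k (Y ω) ∂μ :=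
        lintegral_tsum fun k => ((hh.comp ((measurable_shift k).comp hY)).mul
          ((measurable_exIndGT 1 k).comp hY)).aemeasurable
    _ = ∑' k, ∫⁻ ω, h (Y ω) * exIndGT 1 (-k) (Y ω) ∂μ := tsum_congr (hTI h hh)
    _ = ∑' k, ∫⁻ ω, h (Y ω) * exIndGT 1 k (Y ω) ∂μ :=
        (Equiv.neg (Fin d → ℤ)).tsum_eq fun k => ∫⁻ ω, h (Y ω) * exIndGT 1 k (Y ω) ∂μ
    _ = ∫⁻ ω, ∑' k, h (Y ω) * exIndGT 1 k (Y ω) ∂μ :=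
        (lintegral_tsum fun k => ((hh.comp hY).mul
          ((measurable_exIndGT 1 k).comp hY)).aemeasurable).symm
    _ = ∫⁻ ω, {ω | F.Afm (Y ω) = 0}.indicator 1 ω ∂μ := by
        refine lintegral_congr_ae ?_
        filter_upwards [hl0, hexc] with ω h0 h1
        rw [ENNReal.tsum_mul_left, ← encard_excSet_eq_tsum]
        have hpos : ((excSet (Y ω)).encard : ℝ≥0∞) ≠ 0 := by
          simpa using Set.nonempty_iff_ne_empty.1 ⟨0, h1⟩
        have htop : ((excSet (Y ω)).encard : ℝ≥0∞) ≠ ⊤ := by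
          simpa using finite_excSet h0
        by_cases hA : F.Afm (Y ω) = 0
        · simp [h_def, hA, ENNReal.inv_mul_cancel hpos htop]
        · simp [h_def, hA]
    _ = μ {ω | F.Afm (Y ω) = 0} :=
        lintegral_indicator_one (hY (F.measurableSet_Afm_eq 0))

open Classical in
/-- Among all shifts `κ θ_k x / |x_k|`, only the one at the first maximum is anchored at `0`. -/
lemma tsum_anchored_shift (F : FirstMaxData d) {α : ℝ} (hα : 0 < α) {h : RField d → ℝ≥0∞}
    (hh : ShiftInvariantOn (l0set d) h) {x : RField d} (hx : x ∈ l0set d) {κ : ℝ} (hκ : κ ≠ 0) :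
    ∑' k : Fin d → ℤ, (if x k = 0 then 0 else ENNReal.ofReal (|x k| ^ α) *
        {y | F.Afm y = 0}.indicator h (κ • |x k|⁻¹ • shift k x))
      = h (κ • (supNorm x)⁻¹ • x) * ENNReal.ofReal (supNorm x ^ α) := by
  by_cases hx0 : x = 0
  · simp [hx0, supNorm_zero, Real.zero_rpow hα.ne']
  have hA (k : Fin d → ℤ) (hk : x k ≠ 0) :
      F.Afm (κ • |x k|⁻¹ • shift k x) = F.Afm x - k := by
    rw [smul_smul, F.Afm_smul (shift_mem_l0set hx k) (shift_ne_zero hx0 k) (by positivity),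
      F.Afm_shift hx hx0]
  have hmax := F.mem_argmax x hx hx0
  have hne : x (F.Afm x) ≠ 0 := by
    intro h0
    refine hx0 (funext fun i => ?_)
    simpa [← hmax, h0] using abs_le_supNorm hx i
  rw [tsum_eq_single (F.Afm x)]
  · rw [if_neg hne, Set.indicator_of_mem (by simp [hA _ hne]), hmax, mul_comm, ← shift_smul,
      ← shift_smul, hh _ (smul_mem_l0set (smul_mem_l0set hx _) _)]
  · intro k hk
    by_cases hk0 : x k = 0
    · simp [hk0]
    · simp [hk0, hA k hk0, sub_eq_zero, hk.symm]

open Classical in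
/-- **moving averages: anchored spectral tail process and extremal index.**
Let `C ∈ l₀` with `E[‖C‖^α] > 0` and `c = Σ_k E[|C_k|^α] ∈ (0,∞)`, `κ ∈ {−1,1}`
independent of `C`. Let `Y` be a tail process of index `α` whose spectral process
`Θ = Y/|Y_0|` satisfies `E[h(Θ)] = c⁻¹ E[Σ_k h(κ θ_k C/|C_k|) |C_k|^α]`, and let `Q` have
law `P(Q ∈ ·) = E[1{κ C/‖C‖ ∈ ·} ‖C‖^α] / E[‖C‖^α]`. Then `Q` is a representative of the
anchored spectral tail process, and the extremal index satisfies
`ϑ = E[1/|e(Y)|] = E[‖C‖^α] / Σ_k E[|C_k|^α]`. -/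
theorem moving_average_anchored_spectral
    {Ω : Type*} [MeasurableSpace Ω] (μ : Measure Ω) [IsProbabilityMeasure μ]
    {Ωy : Type*} [MeasurableSpace Ωy] (μy : Measure Ωy) [IsProbabilityMeasure μy]
    {Ωq : Type*} [MeasurableSpace Ωq] (μq : Measure Ωq) [IsProbabilityMeasure μq]
    (α : ℝ) (hα : 0 < α)
    (C : Ω → RField d) (hC : Measurable C) (hCl0 : ∀ᵐ ω ∂μ, C ω ∈ l0set d)
    (c : ℝ≥0∞) (hcdef : c = ∑' k : Fin d → ℤ, ∫⁻ ω, ENNReal.ofReal (|C ω k| ^ α) ∂μ)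
    (hc0 : 0 < c) (hcT : c ≠ ⊤)
    (hCnorm : 0 < ∫⁻ ω, ENNReal.ofReal (supNorm (C ω) ^ α) ∂μ)
    (κ : Ω → ℝ) (hκ : Measurable κ) (hκval : ∀ᵐ ω ∂μ, κ ω = 1 ∨ κ ω = -1)
    (hκind : IndepFun κ C μ)
    (Y : Ωy → RField d) (hY : Measurable Y) (hTI : TailIdentity μy Y)
    (hPar : IsPareto μy (fun ω => |Y ω 0|) α)
    (Θ : Ωy → RField d) (hΘdef : Θ = fun ω => fun i => Y ω i / |Y ω 0|)
    (hind : IndepFun (fun ω => |Y ω 0|) Θ μy)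
    (hl0 : ∀ᵐ ω ∂μy, Θ ω ∈ l0set d)
    (hlaw : ∀ h : RField d → ℝ≥0∞, Measurable h →
      ∫⁻ ω, h (Θ ω) ∂μy
        = c⁻¹ * ∫⁻ ω, ∑' k : Fin d → ℤ,
            (if C ω k = 0 then 0
              else ENNReal.ofReal (|C ω k| ^ α) *
                h (κ ω • |C ω k|⁻¹ • shift k (C ω))) ∂μ)
    (F : FirstMaxData d)
    (Q : Ωq → RField d) (hQ : Measurable Q) (hQl0 : ∀ᵐ ω ∂μq, Q ω ∈ l0set d)
    (hQlaw : ∀ h : RField d → ℝ≥0∞, Measurable h →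
      ∫⁻ ω, h (Q ω) ∂μq
        = (∫⁻ ω, ENNReal.ofReal (supNorm (C ω) ^ α) ∂μ)⁻¹ *
            ∫⁻ ω, h (κ ω • (supNorm (C ω))⁻¹ • C ω) *
              ENNReal.ofReal (supNorm (C ω) ^ α) ∂μ) :
    IsSpectralRep μy Θ F μq Q ∧
      ∫⁻ ω, ((excSet (Y ω)).encard)⁻¹ ∂μy
        = (∫⁻ ω, ENNReal.ofReal (supNorm (C ω) ^ α) ∂μ) / c := by
  have hΘ : Measurable Θ := by
    rw [hΘdef]
    exact measurable_pi_lambda _ fun i => ((measurable_pi_apply i).comp hY).div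
      ((measurable_pi_apply 0).comp hY).abs
  set m := ∫⁻ ω, ENNReal.ofReal (supNorm (C ω) ^ α) ∂μ
  have key (h : RField d → ℝ≥0∞) (hh : Measurable h) (hinv : ShiftInvariantOn (l0set d) h) :
      ∫⁻ x in {x | F.Afm x = 0}, h x ∂(Measure.map Θ μy)
        = c⁻¹ * ∫⁻ ω, h (κ ω • (supNorm (C ω))⁻¹ • C ω) *
              ENNReal.ofReal (supNorm (C ω) ^ α) ∂μ := by
    have hhA := hh.indicator (F.measurableSet_Afm_eq 0)
    rw [← lintegral_indicator (F.measurableSet_Afm_eq 0), lintegral_map hhA hΘ, hlaw _ hhA]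
    congr 1
    refine lintegral_congr_ae ?_
    filter_upwards [hCl0, hκval] with ω h0 h1
    exact tsum_anchored_shift F hα hinv h0 (by rcases h1 with h1 | h1 <;> simp [h1])
  have hprob : Measure.map Θ μy {x | F.Afm x = 0} = c⁻¹ * m := by
    simpa using key 1 measurable_const fun _ _ _ => rfl
  have hcinv0 : c⁻¹ ≠ 0 := ENNReal.inv_ne_zero.2 hcT
  have hcinvT : c⁻¹ ≠ ⊤ := ENNReal.inv_ne_top.2 hc0.ne'
  refine ⟨fun h hh hinv => ?_, ?_⟩
  · rw [hQlaw h hh, ProbabilityTheory.cond, lintegral_smul_measure, key h hh hinv, hprob,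
      ENNReal.mul_inv (.inl hcinv0) (.inl hcinvT), smul_eq_mul, mul_mul_mul_comm,
      ENNReal.inv_mul_cancel hcinv0 hcinvT, one_mul]
  · have hexc : ∀ᵐ ω ∂μy, 1 < |Y ω 0| := by
      have hmeas : MeasurableSet {ω | 1 < |Y ω 0|} :=
        measurableSet_lt measurable_const ((measurable_pi_apply 0).comp hY).abs
      exact (mem_ae_iff_prob_eq_one hmeas).2 (by simpa using hPar 1 le_rfl)
    have hYΘ (ω : Ωy) (h1 : 1 < |Y ω 0|) : Y ω = |Y ω 0| • Θ ω := by
      ext i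
      simp [hΘdef, mul_div_cancel₀ _ (one_pos.trans h1).ne']
    have hYl0 : ∀ᵐ ω ∂μy, Y ω ∈ l0set d := by
      filter_upwards [hl0, hexc] with ω h0 h1
      rw [hYΘ ω h1]
      exact smul_mem_l0set h0 _
    rw [hTI.lintegral_inv_encard hY hYl0 hexc F, div_eq_mul_inv, mul_comm, ← hprob,
      Measure.map_apply hΘ (F.measurableSet_Afm_eq 0)]
    refine measure_congr ?_
    filter_upwards [hl0, hexc] with ω h0 h1
    have h1' := one_pos.trans h1
    have hne : Θ ω ≠ 0 := fun h => by
      have h0' := congrFun (hYΘ ω h1) 0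
      simp only [h, smul_zero, Pi.zero_apply] at h0'
      simp [h0'] at h1'
    refine propext (Eq.congr_left ?_)
    conv_lhs => rw [hYΘ ω h1]
    exact F.Afm_smul h0 hne h1'.ne'
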